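/- Let g ∈ ℝ, let γ ∈ (0,1), let f : ℝ → ℝ be a nondecreasing, continuous, 1-Lipschitz function, and let ρ be a real-valued functional on probability measures on ℝ with finite first moment satisfying |ρ(μ') − ρ(ν')| ≤ W₁(μ', ν') for all such measures μ', ν'. Define T(μ) = δ_{g − γ·ρ(f_*μ)}. Then there exists a unique probability measure Z* on ℝ with finite first moment such that T(Z*) = Z*; moreover Z* is the Dirac measure δ_{x*} at the unique real number x* satisfying x* = g − γ·ρ(f_*δ_{x*}). -/

import Mathlib

open MeasureTheory Set

/-- The cumulative distribution function of a measure on `ℝ`: `F_μ(x) = μ((−∞, x])`. -/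
noncomputable def cdf (μ : Measure ℝ) (x : ℝ) : ℝ := (μ (Iic x)).toReal

/-- The quantile function `Q_μ(p) = inf {x | F_μ(x) ≥ p}`. -/
noncomputable def quantile (μ : Measure ℝ) (p : ℝ) : ℝ := sInf {x : ℝ | p ≤ cdf μ x}

/-- The Wasserstein-1 distance `W₁(μ, ν) = ∫₀¹ |Q_μ(p) − Q_ν(p)| dp`. -/
noncomputable def W1 (μ ν : Measure ℝ) : ℝ :=
  ∫ p in Ioo (0:ℝ) 1, |quantile μ p - quantile ν p|

/-- The risk-sensitive distributional Bellman operator `T(μ) = δ_{g − γ·ρ(f_*μ)}`. -/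
noncomputable def bellmanT (g γ : ℝ) (f : ℝ → ℝ) (ρ : Measure ℝ → ℝ) (μ : Measure ℝ) :
    Measure ℝ :=
  Measure.dirac (g - γ * ρ (Measure.map f μ))

theorem cdf_dirac (a x : ℝ) : cdf (Measure.dirac a) x = if a ≤ x then 1 else 0 := by
  by_cases h : a ≤ x <;> simp [cdf, Measure.dirac_apply' _ measurableSet_Iic, h]

theorem quantile_dirac (a : ℝ) {p : ℝ} (hp : p ∈ Ioo (0:ℝ) 1) :
    quantile (Measure.dirac a) p = a := by
  have h : {x : ℝ | p ≤ cdf (Measure.dirac a) x} = Ici a := by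
    ext x
    by_cases hx : a ≤ x
    · simp [cdf_dirac, hx, hp.2.le]
    · simp [cdf_dirac, hx, hp.1]
  rw [quantile, h, csInf_Ici]

theorem W1_dirac (a b : ℝ) : W1 (Measure.dirac a) (Measure.dirac b) = |a - b| := by
  have h : W1 (Measure.dirac a) (Measure.dirac b) = ∫ _ in Ioo (0:ℝ) 1, |a - b| :=
    setIntegral_congr_fun measurableSet_Ioo fun p hp => by
      simp only [quantile_dirac _ hp]
  simp [h]

theorem integrable_id_dirac (a : ℝ) : Integrable (fun x : ℝ => x) (Measure.dirac a) :=
  integrable_dirac (by simp)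

/-- A `γ`-Lipschitz self-map of `ℝ` with `0 ≤ γ < 1` has a unique fixed point. -/
theorem existsUnique_fixedPoint_of_lipschitz {γ : ℝ} (hγ₀ : 0 ≤ γ) (hγ₁ : γ < 1) {h : ℝ → ℝ}
    (hh : ∀ x y, |h x - h y| ≤ γ * |x - y|) : ∃! x, x = h x := by
  have hc : ContractingWith ⟨γ, hγ₀⟩ h :=
    ⟨hγ₁, LipschitzWith.of_dist_le_mul fun x y => hh x y⟩
  exact ⟨ContractingWith.fixedPoint h hc, hc.fixedPoint_isFixedPt.symm,
    fun y hy => hc.fixedPoint_unique hy.symm⟩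

/-- Existence of a unique fixed-point distribution of the risk-sensitive Bellman operator,
which is the Dirac measure at the unique real `x*` with `x* = g − γ·ρ(f_*δ_{x*})`. -/
theorem bellman_unique_fixed_point
    (g γ : ℝ) (hγ : γ ∈ Ioo (0:ℝ) 1)
    (f : ℝ → ℝ) (hf_mono : Monotone f) (hf_cont : Continuous f)
    (hf_lip : ∀ x y : ℝ, |f x - f y| ≤ |x - y|)
    (ρ : Measure ℝ → ℝ)
    (hρ : ∀ μ' ν' : Measure ℝ, IsProbabilityMeasure μ' → IsProbabilityMeasure ν' →
      Integrable (fun x => x) μ' → Integrable (fun x => x) ν' →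
      |ρ μ' - ρ ν'| ≤ W1 μ' ν') :
    (∃! Z : Measure ℝ,
        IsProbabilityMeasure Z ∧ Integrable (fun x => x) Z ∧ bellmanT g γ f ρ Z = Z) ∧
    (∃! x : ℝ, x = g - γ * ρ (Measure.map f (Measure.dirac x))) ∧
    (∀ (Z : Measure ℝ) (x : ℝ),
      (IsProbabilityMeasure Z ∧ Integrable (fun y => y) Z ∧ bellmanT g γ f ρ Z = Z) →
      x = g - γ * ρ (Measure.map f (Measure.dirac x)) →
      Z = Measure.dirac x) := by
  have hlip : ∀ x y : ℝ, |(g - γ * ρ (Measure.map f (Measure.dirac x))) -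
      (g - γ * ρ (Measure.map f (Measure.dirac y)))| ≤ γ * |x - y| := by
    intro x y
    rw [Measure.map_dirac' hf_cont.measurable, Measure.map_dirac' hf_cont.measurable,
      sub_sub_sub_cancel_left, ← mul_sub, abs_mul, abs_of_pos hγ.1]
    refine mul_le_mul_of_nonneg_left ?_ hγ.1.le
    calc |ρ (Measure.dirac (f y)) - ρ (Measure.dirac (f x))|
        ≤ W1 (Measure.dirac (f y)) (Measure.dirac (f x)) :=
          hρ _ _ inferInstance inferInstance (integrable_id_dirac _) (integrable_id_dirac _)
      _ = |f y - f x| := W1_dirac _ _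
      _ ≤ |y - x| := hf_lip y x
      _ = |x - y| := abs_sub_comm y x
  have hex := existsUnique_fixedPoint_of_lipschitz hγ.1.le hγ.2 hlip
  have huniq : ∀ (Z : Measure ℝ) (x : ℝ), bellmanT g γ f ρ Z = Z →
      x = g - γ * ρ (Measure.map f (Measure.dirac x)) → Z = Measure.dirac x := by
    intro Z x hZ hx
    have hz : Measure.dirac (g - γ * ρ (Measure.map f Z)) = Z := hZ
    have hfix : g - γ * ρ (Measure.map f Z) =
        g - γ * ρ (Measure.map f (Measure.dirac (g - γ * ρ (Measure.map f Z)))) := by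
      rw [hz]
    rw [← hex.unique hfix hx, hz]
  refine ⟨?_, hex, fun Z x hZ hx => huniq Z x hZ.2.2 hx⟩
  obtain ⟨x, hx, -⟩ := hex
  refine ⟨Measure.dirac x, ⟨inferInstance, integrable_id_dirac x, ?_⟩,
    fun Z hZ => huniq Z x hZ.2.2 hx⟩
  rw [bellmanT, ← hx]
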